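/- arXiv:math/0403533 — 2 statements merged into one kernel-verified Lean document; each statement's English description precedes it below -/
import Mathlib

section
/- Let A_n be vector polynomials in C^r[x] defined by the recurrence x A_n = A_{n−1} + Σ_{j=0}^{r} a_{n+j−1,j} A_{n+j} (n ≥ 1) with initial conditions A_0 = 0 and A_1,...,A_r satisfying A_{j,j} ≠ 0 and A_{i,j} = 0 for j > i, and assume a_{ℓ,r} ≠ 0 for ℓ ≥ r. Define B_n^{(i)}(x) = Σ_{j=i}^{r} a_{n−i+j,j} A_{n−i+j+1}(x) and B_n(x) = det(B_n^{(1)}(x), ..., B_n^{(r)}(x)). Then B_n(x) = γ_n P_n(x), where P_n are the monic polynomials defined by x P_n = P_{n+1} + Σ_{j=0}^{r} a_{n,j} P_{n−j}, and γ_n = (∏_{j=1}^{r} A_{j,j} / ∏_{ℓ=r}^{n−1} a_{ℓ,r}) · (−1)^{⌊s/2⌋+⌊(r−s)/2⌋} with n = mr + s, 0 < s ≤ r. -/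
open Polynomial

/-- `B_n^{(i)} = ∑_{j=i}^{r} a_{n-i+j,j} A_{n-i+j+1}` (componentwise; the index `n-i+j` is
written `n+j-i`, which is safe since `j ≥ i`). -/
noncomputable def Bvec (r : ℕ) (a : ℕ → ℕ → ℂ) (A : ℕ → Fin r → Polynomial ℂ)
    (n i : ℕ) (k : Fin r) : Polynomial ℂ :=
  ∑ j ∈ Finset.Icc i r, a (n + j - i) j • A (n + j - i + 1) k

/-- `B_n = det(B_n^{(1)}, …, B_n^{(r)})`, the determinant of the `r × r` matrix whose columns
are the vector polynomials `B_n^{(i)}`. -/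
noncomputable def Bdet (r : ℕ) (a : ℕ → ℕ → ℂ) (A : ℕ → Fin r → Polynomial ℂ)
    (n : ℕ) : Polynomial ℂ :=
  Matrix.det (Matrix.of fun k i : Fin r => Bvec r a A n (i.val + 1) k)

/-- `P_{n-i}`, with the convention that polynomials of negative index vanish. -/
noncomputable def backShift (P : ℕ → Polynomial ℂ) (n i : ℕ) : Polynomial ℂ :=
  if i ≤ n then P (n - i) else 0

lemma backShift_succ_succ (P : ℕ → Polynomial ℂ) (n i : ℕ) :
    backShift P (n + 1) (i + 1) = backShift P n i := by
  simp [backShift]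

lemma backShift_zero (P : ℕ → Polynomial ℂ) (n : ℕ) : backShift P n 0 = P n := by
  simp [backShift]

lemma Bvec_of_lt {r i : ℕ} (a : ℕ → ℕ → ℂ) (A : ℕ → Fin r → Polynomial ℂ) (n : ℕ) (k : Fin r)
    (h : r < i) : Bvec r a A n i k = 0 := by
  simp [Bvec, Finset.Icc_eq_empty_of_lt h]

lemma Bvec_eq_smul_add {r i : ℕ} (a : ℕ → ℕ → ℂ) (A : ℕ → Fin r → Polynomial ℂ) (n : ℕ)
    (k : Fin r) (h : i ≤ r) :
    Bvec r a A n i k = a n i • A (n + 1) k + Bvec r a A (n + 1) (i + 1) k := by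
  unfold Bvec
  rw [← Finset.add_sum_Ioc_eq_sum_Icc h, ← Finset.Icc_add_one_left_eq_Ioc, Nat.add_sub_cancel]
  congr 1
  refine Finset.sum_congr rfl fun j _ => ?_
  rw [show n + 1 + j - (i + 1) = n + j - i by omega]

lemma Bvec_zero {r : ℕ} (a : ℕ → ℕ → ℂ) (A : ℕ → Fin r → Polynomial ℂ)
    (hArec : ∀ n, 1 ≤ n → ∀ k : Fin r,
      X * A n k = A (n - 1) k +
        ∑ j ∈ Finset.range (r + 1), a (n + j - 1) j • A (n + j) k) (n : ℕ) (k : Fin r) :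
    Bvec r a A n 0 k = X * A (n + 1) k - A n k := by
  rw [hArec (n + 1) (by omega) k, Nat.add_sub_cancel, add_sub_cancel_left, Bvec,
    Finset.range_eq_Ico, Finset.Ico_add_one_right_eq_Icc]
  refine Finset.sum_congr rfl fun j _ => ?_
  rw [show n + 1 + j - 1 = n + j - 0 by omega, show n + 1 + j = n + j - 0 + 1 by omega]

/-- The Christoffel–Darboux identity for the two dual recurrences. -/
lemma sum_backShift_mul_Bvec {r : ℕ} (a : ℕ → ℕ → ℂ) (A : ℕ → Fin r → Polynomial ℂ)
    (hA0 : ∀ k : Fin r, A 0 k = 0)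
    (hArec : ∀ n, 1 ≤ n → ∀ k : Fin r,
      X * A n k = A (n - 1) k +
        ∑ j ∈ Finset.range (r + 1), a (n + j - 1) j • A (n + j) k)
    (P : ℕ → Polynomial ℂ)
    (hPrec : ∀ n, X * P n = P (n + 1) +
      ∑ j ∈ Finset.range (r + 1), a n j • backShift P n j) (n : ℕ) (k : Fin r) :
    ∑ i ∈ Finset.range r, backShift P n (i + 1) * Bvec r a A n (i + 1) k = P n * A n k := by
  induction n with
  | zero => simp [backShift, hA0]
  | succ n ih =>
    have hlast : ∑ i ∈ Finset.range r, backShift P n i * Bvec r a A (n + 1) (i + 1) k =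
        ∑ i ∈ Finset.range (r + 1), backShift P n i * Bvec r a A (n + 1) (i + 1) k := by
      rw [Finset.sum_range_succ, Bvec_of_lt a A _ k (Nat.lt_succ_self r), mul_zero, add_zero]
    have hsplit : ∑ i ∈ Finset.range (r + 1), backShift P n i * Bvec r a A (n + 1) (i + 1) k =
        ∑ i ∈ Finset.range (r + 1), backShift P n i * Bvec r a A n i k -
          (∑ i ∈ Finset.range (r + 1), a n i • backShift P n i) * A (n + 1) k := by
      rw [Finset.sum_mul, ← Finset.sum_sub_distrib]
      refine Finset.sum_congr rfl fun i hi => ?_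
      rw [Bvec_eq_smul_add a A n k (Nat.lt_succ_iff.mp (Finset.mem_range.mp hi)),
        smul_eq_C_mul, smul_eq_C_mul]
      ring
    simp_rw [backShift_succ_succ]
    rw [hlast, hsplit, Finset.sum_range_succ', ih, backShift_zero, Bvec_zero a A hArec]
    linear_combination A (n + 1) k * hPrec n

lemma monic_and_natDegree_of_recurrence {r : ℕ} (a : ℕ → ℕ → ℂ) (P : ℕ → Polynomial ℂ)
    (hP0 : P 0 = 1)
    (hPrec : ∀ n, X * P n = P (n + 1) +
      ∑ j ∈ Finset.range (r + 1), a n j • backShift P n j) (n : ℕ) :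
    (P n).Monic ∧ (P n).natDegree = n := by
  induction n using Nat.strong_induction_on with
  | _ n ih =>
    cases n with
    | zero => simp [hP0]
    | succ n =>
      obtain ⟨hm, hd⟩ := ih n (Nat.lt_succ_self n)
      have hXm : (X * P n).Monic := monic_X.mul hm
      have hXd : (X * P n).natDegree = n + 1 := by
        rw [natDegree_X_mul hm.ne_zero, hd]
      have hlt : (∑ j ∈ Finset.range (r + 1), a n j • backShift P n j).degree <
          (X * P n).degree := by
        rw [degree_eq_natDegree hXm.ne_zero, hXd, ← mem_degreeLT]
        refine Submodule.sum_mem _ fun j _ => Submodule.smul_mem _ _ ?_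
        rw [backShift]
        split_ifs with h
        · obtain ⟨hm', hd'⟩ := ih (n - j) (by omega)
          rw [mem_degreeLT, degree_eq_natDegree hm'.ne_zero, hd']
          exact_mod_cast (by omega : n - j < n + 1)
        · exact Submodule.zero_mem _
      rw [eq_sub_of_add_eq (hPrec n).symm]
      exact ⟨hXm.sub_of_left hlt,
        (natDegree_eq_of_degree_eq (degree_sub_eq_left_of_degree_lt hlt)).trans hXd⟩

lemma Matrix.det_eq_of_forall_col_eq_smul_add_const {n R : Type*} [Fintype n] [DecidableEq n]
    [CommRing R] {M N : Matrix n n R} (c : n → R) (k : n) (hk : c k = 0)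
    (h : ∀ i j, M i j = N i j + c j * N i k) : M.det = N.det := by
  rw [← Matrix.det_transpose M, ← Matrix.det_transpose N]
  exact Matrix.det_eq_of_forall_row_eq_smul_add_const c k hk fun i j => h j i

/-- Replacing the first column `B_{n+1}^{(1)}` by `A_{n+1}` gives, up to a cyclic permutation of
the columns, the matrix of `B_n`. -/
lemma smul_det_updateCol_zero {q : ℕ} (a : ℕ → ℕ → ℂ) (A : ℕ → Fin (q + 1) → Polynomial ℂ)
    (n : ℕ) :
    C (a n (q + 1)) * ((Matrix.of fun k i : Fin (q + 1) =>
      Bvec (q + 1) a A (n + 1) (i.val + 1) k).updateCol 0 (A (n + 1))).det =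
      (-1) ^ q * Bdet (q + 1) a A n := by
  have hperm := Matrix.det_permute' (finRotate (q + 1)).symm
    (Matrix.of fun k i : Fin (q + 1) => Bvec (q + 1) a A n (i.val + 1) k)
  rw [Equiv.Perm.sign_symm, sign_finRotate] at hperm
  have hsign : (((((-1) ^ (q + 1 - 1) : ℤˣ) : ℤ)) : Polynomial ℂ) = (-1) ^ q := by
    simp
  rw [hsign] at hperm
  rw [Bdet, ← hperm]
  have hzero : ∀ k, Bvec (q + 1) a A n (q + 1) k = C (a n (q + 1)) * A (n + 1) k := fun k => by
    rw [Bvec_eq_smul_add a A n k le_rfl, Bvec_of_lt a A _ k (Nat.lt_succ_self _), add_zero,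
      smul_eq_C_mul]
  have hrot0 : (finRotate (q + 1)).symm 0 = Fin.last q := by
    rw [Equiv.symm_apply_eq, finRotate_last]
  have hrot (i : Fin q) : (finRotate (q + 1)).symm i.succ = i.castSucc := by
    rw [Equiv.symm_apply_eq, finRotate_apply, Fin.coeSucc_eq_succ]
  have hcol : ((Matrix.of fun k i : Fin (q + 1) => Bvec (q + 1) a A n (i.val + 1) k).submatrix
      id (finRotate (q + 1)).symm).det =
      (((Matrix.of fun k i : Fin (q + 1) => Bvec (q + 1) a A n (i.val + 1) k).submatrix
      id (finRotate (q + 1)).symm).updateCol 0 (C (a n (q + 1)) • A (n + 1))).det := by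
    congr 1
    ext1 k i
    refine Fin.cases ?_ (fun i => ?_) i
    · simp [hrot0, hzero]
    · simp
  rw [hcol, Matrix.det_updateCol_smul]
  congr 1
  refine Matrix.det_eq_of_forall_col_eq_smul_add_const
    (Fin.cases 0 fun i : Fin q => -C (a n (i.val + 1))) 0 rfl fun k i => ?_
  refine Fin.cases ?_ (fun i => ?_) i
  · simp
  · have h := Bvec_eq_smul_add a A n k (i := i.val + 1) (by omega)
    simp [hrot, h, smul_eq_C_mul]

/-- The determinants `B_n` obey a first-order recurrence with coefficients given by `P_n`. -/
lemma smul_P_mul_Bdet_succ {q : ℕ} (a : ℕ → ℕ → ℂ) (A : ℕ → Fin (q + 1) → Polynomial ℂ)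
    (hA0 : ∀ k, A 0 k = 0)
    (hArec : ∀ n, 1 ≤ n → ∀ k,
      X * A n k = A (n - 1) k +
        ∑ j ∈ Finset.range (q + 1 + 1), a (n + j - 1) j • A (n + j) k)
    (P : ℕ → Polynomial ℂ)
    (hPrec : ∀ n, X * P n = P (n + 1) +
      ∑ j ∈ Finset.range (q + 1 + 1), a n j • backShift P n j) (n : ℕ) :
    C (a n (q + 1)) * (P n * Bdet (q + 1) a A (n + 1)) =
      (-1) ^ q * (P (n + 1) * Bdet (q + 1) a A n) := by
  have hcramer := Matrix.det_updateCol_sum (Matrix.of fun k i : Fin (q + 1) =>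
    Bvec (q + 1) a A (n + 1) (i.val + 1) k) 0 (fun i => backShift P n i.val)
  have hcol : (fun k : Fin (q + 1) => ∑ i : Fin (q + 1), backShift P n i.val •
      (Matrix.of fun k i : Fin (q + 1) => Bvec (q + 1) a A (n + 1) (i.val + 1) k) k i) =
      P (n + 1) • A (n + 1) := by
    ext1 k
    rw [Pi.smul_apply, smul_eq_mul, ← sum_backShift_mul_Bvec a A hA0 hArec P hPrec,
      Finset.sum_range]
    simp [backShift_succ_succ]
  rw [hcol, Matrix.det_updateCol_smul, Fin.val_zero, backShift_zero, smul_eq_mul] at hcramer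
  rw [Bdet, ← hcramer]
  linear_combination P (n + 1) * smul_det_updateCol_zero a A n

lemma sign_revPerm (n : ℕ) : Equiv.Perm.sign (@Fin.revPerm n) = (-1) ^ (n / 2) := by
  have h : Equiv.Perm.sign (@Fin.revPerm n) = (-1) ^ (n * (n - 1) / 2) := by
    rw [Equiv.Perm.sign_eq_prod_prod_Ioi, ← Finset.sum_range_id_mul_two,
      Nat.mul_div_cancel _ two_pos, ← Finset.sum_range_reflect, Finset.sum_range,
      ← Finset.prod_pow_eq_pow_sum]
    refine Finset.prod_congr rfl fun i _ => ?_
    rw [← Fin.card_Ioi, ← Finset.prod_const]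
    refine Finset.prod_congr rfl fun j hj => if_neg ?_
    simpa using (Finset.mem_Ioi.mp hj).le
  rw [h]
  apply neg_one_pow_congr
  rw [Nat.even_iff, Nat.even_iff]
  obtain ⟨m, rfl | rfl⟩ := n.even_or_odd'
  · rw [mul_assoc, Nat.mul_div_cancel_left _ two_pos, Nat.mul_div_cancel_left _ two_pos]
    cases m with
    | zero => rfl
    | succ m => rw [show 2 * (m + 1) - 1 = 2 * m + 1 by omega, Nat.mul_mod]; simp
  · rw [Nat.add_sub_cancel, mul_left_comm, Nat.mul_div_cancel_left _ two_pos, Nat.mul_mod,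
      show (2 * m + 1) / 2 = m by omega]
    simp

lemma Bdet_zero {r : ℕ} (a : ℕ → ℕ → ℂ)
    (hconv : ∀ ℓ1 ℓ2 : ℕ, ℓ1 < ℓ2 → ℓ2 ≤ r → a ℓ1 ℓ2 = 1)
    (A : ℕ → Fin r → Polynomial ℂ)
    (hAtri : ∀ i j : Fin r, i.val < j.val → A (i.val + 1) j = 0) :
    Bdet r a A 0 = (-1) ^ (r / 2) * ∏ j : Fin r, A (j.val + 1) j := by
  have hB (k i : Fin r) : Bvec r a A 0 (i.rev.val + 1) k =
      ∑ l ∈ Finset.range (i.val + 1), A (l + 1) k := by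
    have hi : r = i.rev.val + 1 + i.val := by rw [Fin.val_rev]; omega
    rw [Bvec, ← Finset.Ico_add_one_right_eq_Icc, Finset.sum_Ico_eq_sum_range,
      show r + 1 - (i.rev.val + 1) = i.val + 1 by omega]
    refine Finset.sum_congr rfl fun l hl => ?_
    have hl := Finset.mem_range.mp hl
    rw [show 0 + (i.rev.val + 1 + l) - (i.rev.val + 1) = l by omega,
      hconv _ _ (by omega) (by omega), one_smul]
  have hperm := Matrix.det_permute' Fin.revPerm
    (Matrix.of fun k i : Fin r => Bvec r a A 0 (i.val + 1) k)
  have htri : (Matrix.of fun k i : Fin r => Bvec r a A 0 (i.val + 1) k).submatrix id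
      Fin.revPerm = Matrix.of fun k i : Fin r =>
        ∑ l ∈ Finset.range (i.val + 1), A (l + 1) k := by
    ext1 k i
    exact hB k i
  have hvanish {l : ℕ} {k : Fin r} (h : l < k.val) : A (l + 1) k = 0 :=
    hAtri ⟨l, h.trans k.isLt⟩ k h
  rw [htri, Matrix.det_of_isUpperTriangular, sign_revPerm] at hperm
  · have hdiag : ∀ i : Fin r, (Matrix.of fun k i : Fin r =>
        ∑ l ∈ Finset.range (i.val + 1), A (l + 1) k) i i = A (i.val + 1) i := fun i => by
      rw [Matrix.of_apply, Finset.sum_range_succ,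
        Finset.sum_eq_zero fun l hl => hvanish (Finset.mem_range.mp hl), zero_add]
    simp_rw [hdiag] at hperm
    rw [hperm, ← Bdet]
    push_cast
    rw [← mul_assoc, ← mul_pow]
    simp
  · intro k i hik
    rw [Matrix.of_apply]
    refine Finset.sum_eq_zero fun l hl => hvanish ?_
    have := Finset.mem_range.mp hl
    have : i.val < k.val := hik
    omega

/-- under the type I recurrence with `A_0 = 0`, triangular constant initial
conditions with nonzero diagonal, and `a_{ℓ,r} ≠ 0` for `ℓ ≥ r` (convention `a_{ℓ1,ℓ2} = 1`
for `ℓ1 < ℓ2 ≤ r`), one has `B_n = γ_n P_n` where `P_n` are the monic polynomials of the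
type II recurrence and
`γ_n = (∏_{j=1}^r A_{j,j} / ∏_{ℓ=r}^{n-1} a_{ℓ,r}) (−1)^{⌊s/2⌋+⌊(r−s)/2⌋}`, `n = mr+s`,
`0 < s ≤ r`. -/
theorem Bdet_eq_gamma_mul_P (r : ℕ) (hr : 0 < r) (a : ℕ → ℕ → ℂ)
    (hconv : ∀ ℓ1 ℓ2 : ℕ, ℓ1 < ℓ2 → ℓ2 ≤ r → a ℓ1 ℓ2 = 1)
    (har : ∀ ℓ, r ≤ ℓ → a ℓ r ≠ 0)
    (A : ℕ → Fin r → Polynomial ℂ)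
    (hA0 : ∀ k : Fin r, A 0 k = 0)
    (hAconst : ∀ i j : Fin r, (A (i.val + 1) j).degree ≤ 0)
    (hAtri : ∀ i j : Fin r, i.val < j.val → A (i.val + 1) j = 0)
    (hAdiag : ∀ j : Fin r, A (j.val + 1) j ≠ 0)
    (hArec : ∀ n, 1 ≤ n → ∀ k : Fin r,
      X * A n k = A (n - 1) k +
        ∑ j ∈ Finset.range (r + 1), a (n + j - 1) j • A (n + j) k)
    (P : ℕ → Polynomial ℂ) (hP0 : P 0 = 1)
    (hPrec : ∀ n, X * P n = P (n + 1) +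
      ∑ j ∈ Finset.range (r + 1), a n j • (if j ≤ n then P (n - j) else 0)) :
    ∀ n m s : ℕ, 0 < s → s ≤ r → n = m * r + s →
      Bdet r a A n =
        C (((∏ j : Fin r, (A (j.val + 1) j).coeff 0) / ∏ ℓ ∈ Finset.Ico r n, a ℓ r) *
            (-1) ^ (s / 2 + (r - s) / 2)) * P n := by
  obtain ⟨q, rfl⟩ : ∃ q, r = q + 1 := ⟨r - 1, by omega⟩
  have hane (n : ℕ) : a n (q + 1) ≠ 0 := by
    rcases lt_or_ge n (q + 1) with h | h
    · rw [hconv n _ h le_rfl]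
      exact one_ne_zero
    · exact har n h
  have hdiag : ∏ j : Fin (q + 1), A (j.val + 1) j =
      C (∏ j : Fin (q + 1), (A (j.val + 1) j).coeff 0) := by
    rw [map_prod]
    exact Finset.prod_congr rfl fun j _ => eq_C_of_degree_le_zero (hAconst j j)
  have hprod (n : ℕ) : ∏ ℓ ∈ Finset.Ico (q + 1) (n + 1), a ℓ (q + 1) =
      (∏ ℓ ∈ Finset.Ico (q + 1) n, a ℓ (q + 1)) * a n (q + 1) := by
    rcases lt_or_ge n (q + 1) with h | h
    · rw [hconv n _ h le_rfl, Finset.Ico_eq_empty_of_le h, Finset.Ico_eq_empty_of_le h.le]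
      simp
    · exact Finset.prod_Ico_succ_top h _
  have key (n : ℕ) : C (∏ ℓ ∈ Finset.Ico (q + 1) n, a ℓ (q + 1)) * Bdet (q + 1) a A n =
      C (∏ j : Fin (q + 1), (A (j.val + 1) j).coeff 0) * (-1) ^ (q * n + (q + 1) / 2) * P n := by
    induction n with
    | zero =>
      rw [Bdet_zero a hconv A hAtri, hdiag, hP0]
      simp
      ring
    | succ n ih =>
      have hPn := (monic_and_natDegree_of_recurrence a P hP0 hPrec n).1.ne_zero
      apply mul_left_cancel₀ hPn
      rw [hprod, C_mul]
      have hstep := smul_P_mul_Bdet_succ a A hA0 hArec P hPrec n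
      rw [show q * (n + 1) + (q + 1) / 2 = q * n + (q + 1) / 2 + q by ring, pow_add]
      linear_combination C (∏ ℓ ∈ Finset.Ico (q + 1) n, a ℓ (q + 1)) * hstep +
        (-1) ^ q * P (n + 1) * ih
  intro n m s hs hsr hn
  have hpar : (q * n + (q + 1) / 2) % 2 = (s / 2 + (q + 1 - s) / 2) % 2 := by
    obtain ⟨t, ht⟩ := Nat.exists_eq_add_of_le hsr
    have hq : (q * (q + 1)) % 2 = 0 := Nat.even_iff.mp (Nat.even_mul_succ_self q)
    have hqn : (q * n) % 2 = (q * s) % 2 := by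
      rw [hn, show q * (m * (q + 1) + s) = q * (q + 1) * m + q * s by ring, Nat.add_mod,
        Nat.mul_mod _ m, hq]
      simp
    rw [show q + 1 - s = t by omega, Nat.add_mod, hqn, Nat.mul_mod q s]
    rcases Nat.mod_two_eq_zero_or_one q with h1 | h1 <;>
      rcases Nat.mod_two_eq_zero_or_one s with h2 | h2 <;> rw [h1, h2] <;> omega
  have hpow : (-1 : Polynomial ℂ) ^ (q * n + (q + 1) / 2) =
      (-1) ^ (s / 2 + (q + 1 - s) / 2) :=
    neg_one_pow_congr (by rw [Nat.even_iff, Nat.even_iff, hpar])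
  have hprod_ne : ∏ ℓ ∈ Finset.Ico (q + 1) n, a ℓ (q + 1) ≠ 0 :=
    Finset.prod_ne_zero_iff.mpr fun ℓ _ => hane ℓ
  apply mul_left_cancel₀ (C_ne_zero.mpr hprod_ne)
  rw [key, ← mul_assoc, ← C_mul, ← mul_assoc, mul_div_cancel₀ _ hprod_ne, hpow]
  simp
end

section
/- Multiple Gaussian quadrature exactness (Borges): if for each j = 1,...,r the quadrature rule Σ_{ℓ=1}^{n} w^{(j)}_{ℓ,n} f(x_{ℓ,n}) with nodes at the n simple zeros x_{1,n},...,x_{n,n} of the type II multiple orthogonal polynomial P_n and interpolatory weights w^{(j)}_{ℓ,n} = ∫ l_{ℓ,n}(x) dμ_j(x) is used, then ∫ h(x) dμ_j(x) = Σ_{ℓ=1}^{n} w^{(j)}_{ℓ,n} h(x_{ℓ,n}) holds for every polynomial h of degree at most n − 1 + ν_n(j). -/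
open Polynomial

/-- The `j`-th entry of the proper multi-index `ν_n`. -/
def properIndex (r n : ℕ) (j : Fin r) : ℕ := (n + r - 1 - j.val) / r

/-- Type II orthogonality conditions (measures identified with moment functionals). -/
def TypeIISol (r : ℕ) (μ : Fin r → (Polynomial ℂ →ₗ[ℂ] ℂ)) (n : ℕ) (P : Polynomial ℂ) : Prop :=
  P.degree ≤ (n : WithBot ℕ) ∧ ∀ j : Fin r, ∀ ℓ < properIndex r n j, μ j (X ^ ℓ * P) = 0

/-- The proper multi-index `ν_n` is normal. -/
def NormalIndex (r : ℕ) (μ : Fin r → (Polynomial ℂ →ₗ[ℂ] ℂ)) (n : ℕ) : Prop :=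
  (∀ P, TypeIISol r μ n P → P = 0 ∨ P.natDegree = n) ∧
  (∀ P Q, TypeIISol r μ n P → TypeIISol r μ n Q → P ≠ 0 → ∃ c : ℂ, Q = c • P)

/-- Weakly complete system: all proper multi-indices are normal. -/
def WeaklyComplete (r : ℕ) (μ : Fin r → (Polynomial ℂ →ₗ[ℂ] ℂ)) : Prop :=
  ∀ n, NormalIndex r μ n

/-- A linear functional that annihilates `X ^ k * P` for all `k < N` annihilates `q * P` for every
polynomial `q` of degree less than `N`. -/
theorem map_mul_eq_zero_of_natDegree_lt {R M : Type*} [CommSemiring R] [AddCommMonoid M]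
    [Module R M] (φ : R[X] →ₗ[R] M) {P q : R[X]} {N : ℕ}
    (hφ : ∀ k < N, φ (X ^ k * P) = 0) (hq : q.natDegree < N) : φ (q * P) = 0 := by
  rw [q.as_sum_range' N hq, Finset.sum_mul, map_sum]
  refine Finset.sum_eq_zero fun k hk => ?_
  rw [← C_mul_X_pow_eq_monomial, mul_assoc, ← smul_eq_C_mul, map_smul,
    hφ k (Finset.mem_range.mp hk), smul_zero]

/-- Interpolatory quadrature is exact on polynomials of degree less than the number of nodes. -/
theorem map_eq_sum_basis_of_degree_lt {F ι : Type*} [Field F] [DecidableEq ι]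
    (φ : F[X] →ₗ[F] F) {s : Finset ι} {v : ι → F} (hv : Set.InjOn v s) {f : F[X]}
    (hf : f.degree < s.card) : φ f = ∑ i ∈ s, φ (Lagrange.basis s v i) * f.eval (v i) := by
  conv_lhs => rw [Lagrange.eq_interpolate hv hf, Lagrange.interpolate_apply, map_sum]
  refine Finset.sum_congr rfl fun i _ => ?_
  rw [← smul_eq_C_mul, map_smul, smul_eq_mul, mul_comm]

/-- Borges: multiple Gaussian quadrature: with nodes at the `n` simple zeros
of the type II multiple orthogonal polynomial `P_n` and interpolatory weights
`w^{(j)}_ℓ = ∫ l_ℓ dμ_j` (Lagrange fundamental polynomials `l_ℓ`), the `j`-th rule is exact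
for all polynomials of degree at most `n − 1 + ν_n(j)`. -/
theorem multiple_gaussian_quadrature (r : ℕ) (hr : 0 < r)
    (μ : Fin r → (Polynomial ℂ →ₗ[ℂ] ℂ)) (hwc : WeaklyComplete r μ)
    (n : ℕ) (hn : 0 < n) (P : Polynomial ℂ)
    (hmonic : P.Monic) (hdeg : P.natDegree = n)
    (horth : TypeIISol r μ n P)
    (x : Fin n → ℂ) (hinj : Function.Injective x)
    (hzeros : P = ∏ ℓ : Fin n, (X - C (x ℓ))) :
    ∀ j : Fin r, ∀ h : Polynomial ℂ, h.natDegree ≤ n - 1 + properIndex r n j →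
      μ j h = ∑ ℓ : Fin n, μ j (Lagrange.basis Finset.univ x ℓ) * h.eval (x ℓ) := by
  intro j h hh
  have hroot (ℓ : Fin n) : P.eval (x ℓ) = 0 := by
    rw [hzeros, eval_prod]
    exact Finset.prod_eq_zero (Finset.mem_univ ℓ) (by simp)
  have hquot : μ j (h /ₘ P * P) = 0 := by
    by_cases hlt : h.degree < P.degree
    · rw [(divByMonic_eq_zero_iff hmonic).mpr hlt, zero_mul, map_zero]
    · have hle : P.natDegree ≤ h.natDegree := natDegree_le_natDegree (not_lt.mp hlt)
      refine map_mul_eq_zero_of_natDegree_lt (μ j) (horth.2 j) ?_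
      rw [natDegree_divByMonic h hmonic]
      omega
  have hrem : (h %ₘ P).degree < (Finset.univ : Finset (Fin n)).card := by
    simpa [degree_eq_natDegree hmonic.ne_zero, hdeg] using degree_modByMonic_lt h hmonic
  have hdecomp := modByMonic_add_div h P
  rw [← hdecomp, mul_comm P, map_add, hquot, add_zero,
    map_eq_sum_basis_of_degree_lt (μ j) hinj.injOn hrem]
  simp [hroot]
end
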